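/- arXiv:2509.21604 — 2 statements merged into one kernel-verified Lean document; each statement's English description precedes it below -/
import Mathlib

section
/- Let $p \leq d - q$. Then there exists a constant $C$ such that for every $\delta \in (0, 1/2]$, $\int_{\Sigma_0 \setminus B_\delta} |x|^{-p}\, d\mathcal{H}^{d-1}(x) \leq C\, \chi_{d,\, p+q}(\delta)$, where $B_\delta \subset \mathbb{R}^d$ is the ball of radius $\delta$ centered at the origin and $\chi_{a,b}(r) = 1$ if $a \neq b$ and $\chi_{a,b}(r) = |\ln r|$ if $a = b$. -/
open MeasureTheory Metric Real Set

theorem EuclideanSpace.norm_le_card_mul_of_forall_abs_le {ι : Type*} [Fintype ι]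
    {x : EuclideanSpace ℝ ι} {a : ℝ} (ha : 0 ≤ a) (hx : ∀ i, |x i| ≤ a) :
    ‖x‖ ≤ Fintype.card ι * a := by
  rw [EuclideanSpace.norm_eq]
  refine Real.sqrt_le_iff.mpr ⟨by positivity, ?_⟩
  calc ∑ i, ‖x i‖ ^ 2 ≤ ∑ _i : ι, a ^ 2 :=
        Finset.sum_le_sum fun i _ ↦ pow_le_pow_left₀ (norm_nonneg _) (hx i) 2
    _ = Fintype.card ι * a ^ 2 := by simp
    _ ≤ (Fintype.card ι * a) ^ 2 := by
        rw [mul_pow]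
        refine mul_le_mul_of_nonneg_right ?_ (sq_nonneg a)
        exact_mod_cast Nat.le_self_pow two_ne_zero _

/-- A set whose secants make a definite angle with a nonzero vector `v` is contained in a Lipschitz
graph over the hyperplane orthogonal to `v`. -/
theorem hausdorffMeasure_le_of_abs_inner_secant_le {n : ℕ} {v : EuclideanSpace ℝ (Fin (n + 1))}
    (hv : v ≠ 0) {S : Set (EuclideanSpace ℝ (Fin (n + 1)))} {ρ : ℝ} (hρ : 0 ≤ ρ)
    (hS : ∀ y ∈ S, ∀ z ∈ S, dist y z ≤ ρ)
    (hinner : ∀ y ∈ S, ∀ z ∈ S, |inner ℝ v (y - z)| ≤ 1 / 2 * ‖v‖ * ‖y - z‖) :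
    μH[(n : ℝ)] S ≤ ENNReal.ofReal ((4 * n) ^ n * ρ ^ n) := by
  rcases S.eq_empty_or_nonempty with rfl | ⟨x, hxS⟩
  · simp
  have : Fact (Module.finrank ℝ (EuclideanSpace ℝ (Fin (n + 1))) = n + 1) := ⟨by simp⟩
  set b := OrthonormalBasis.fromOrthogonalSpanSingleton (𝕜 := ℝ) n hv
  set A : EuclideanSpace ℝ (Fin (n + 1)) → Fin n → ℝ :=
    fun w i ↦ b.repr ((ℝ ∙ v)ᗮ.orthogonalProjectionOnto w) i with hA
  have hAsub : ∀ y z, A y - A z = A (y - z) := fun y z ↦ by ext i; simp [hA]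
  have hAle : ∀ w, ‖A w‖ ≤ ‖w‖ := fun w ↦ by
    refine (pi_norm_le_iff_of_nonneg (norm_nonneg _)).mpr fun i ↦ ?_
    calc ‖A w i‖ ≤ ‖b.repr ((ℝ ∙ v)ᗮ.orthogonalProjectionOnto w)‖ := PiLp.norm_apply_le _ i
      _ ≤ ‖w‖ := by
        rw [LinearIsometryEquiv.norm_map]
        exact Submodule.norm_orthogonalProjectionOnto_apply_le _ w
  have hAge : ∀ w, |inner ℝ v w| ≤ 1 / 2 * ‖v‖ * ‖w‖ → ‖w‖ ≤ 2 * n * ‖A w‖ := fun w hw ↦ by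
    have hv' : 0 < ‖v‖ := norm_pos_iff.mpr hv
    have h1 : ‖(ℝ ∙ v).starProjection w‖ ≤ 1 / 2 * ‖w‖ := by
      rw [Submodule.starProjection_singleton, norm_smul]
      simp only [RCLike.ofReal_real_eq_id, id, norm_div, norm_pow, Real.norm_eq_abs, abs_norm]
      rw [div_mul_eq_mul_div, div_le_iff₀ (by positivity)]
      nlinarith
    have h2 : ‖(ℝ ∙ v)ᗮ.starProjection w‖ ≤ n * ‖A w‖ := by
      rw [Submodule.starProjection_apply, ← Submodule.coe_norm, ← b.repr.norm_map]
      simpa using EuclideanSpace.norm_le_card_mul_of_forall_abs_le (norm_nonneg (A w))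
        fun i ↦ norm_le_pi_norm (A w) i
    have h3 := norm_add_le ((ℝ ∙ v).starProjection w) ((ℝ ∙ v)ᗮ.starProjection w)
    rw [Submodule.starProjection_add_starProjection_orthogonal] at h3
    linarith
  have hanti : AntilipschitzWith (2 * n) fun y : S ↦ A y := by
    refine AntilipschitzWith.of_le_mul_dist fun y z ↦ ?_
    rw [Subtype.dist_eq, dist_eq_norm, dist_eq_norm, hAsub]
    simpa using hAge _ (hinner y y.2 z z.2)
  have himage : (fun y : S ↦ A y) '' univ ⊆ closedBall (A x) ρ := by
    rintro _ ⟨y, -, rfl⟩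
    rw [mem_closedBall, dist_eq_norm, hAsub]
    refine (hAle _).trans ?_
    rw [← dist_eq_norm]
    exact hS y y.2 x hxS
  have hvol : (μH[(n : ℝ)] : Measure (Fin n → ℝ)) = volume := by
    simpa using hausdorffMeasure_pi_real (ι := Fin n)
  calc μH[(n : ℝ)] S = μH[(n : ℝ)] (Subtype.val '' (univ : Set S)) := by simp
    _ = μH[(n : ℝ)] (univ : Set S) :=
        isometry_subtype_coe.hausdorffMeasure_image (Or.inl n.cast_nonneg) _
    _ ≤ ((2 * n : NNReal) : ENNReal) ^ (n : ℝ) * μH[(n : ℝ)] ((fun y : S ↦ A y) '' univ) :=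
        hanti.le_hausdorffMeasure_image n.cast_nonneg _
    _ ≤ ((2 * n : NNReal) : ENNReal) ^ (n : ℝ) * ENNReal.ofReal ((2 * ρ) ^ n) := by
        gcongr
        refine (measure_mono himage).trans_eq ?_
        rw [hvol, Real.volume_pi_closedBall _ hρ, Fintype.card_fin]
    _ = ENNReal.ofReal ((4 * n) ^ n * ρ ^ n) := by
        rw [ENNReal.rpow_natCast, ← ENNReal.ofReal_coe_nnreal, ← ENNReal.ofReal_pow (by positivity),
          ← ENNReal.ofReal_mul (by positivity)]
        congr 1
        push_cast
        rw [← mul_pow, ← mul_pow]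
        ring

/-- If all subsets of `T` of small diameter have measure at most `a`, then a covering of `T` by
cubes bounds the measure of `T`. -/
theorem measure_le_of_forall_subset_dist_le {d : ℕ} (hd : d ≠ 0)
    (μ : Measure (EuclideanSpace ℝ (Fin d)))
    {T : Set (EuclideanSpace ℝ (Fin d))} {r ρ a : ℝ} (hr : 0 ≤ r) (hρ : 0 < ρ) (hT : ∀ x ∈ T, ‖x‖ ≤ r)
    (hsub : ∀ S ⊆ T, (∀ y ∈ S, ∀ z ∈ S, dist y z ≤ ρ) → μ S ≤ ENNReal.ofReal a) :
    μ T ≤ ENNReal.ofReal ((2 * (d * r / ρ) + 3) ^ d * a) := by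
  have hd' : (0 : ℝ) < d := by exact_mod_cast Nat.pos_of_ne_zero hd
  set m := ⌈d * r / ρ⌉₊
  set cell : EuclideanSpace ℝ (Fin d) → Fin d → ℤ := fun x i ↦ ⌊x i * d / ρ⌋
  set F : Finset (Fin d → ℤ) := Fintype.piFinset fun _ ↦ Finset.Icc (-m : ℤ) m
  have hcover : T ⊆ ⋃ k ∈ F, T ∩ cell ⁻¹' {k} := by
    intro x hx
    simp only [mem_iUnion]
    refine ⟨cell x, ?_, hx, rfl⟩
    refine Fintype.mem_piFinset.mpr fun i ↦ Finset.mem_Icc.mpr ?_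
    have hxi : |x i| ≤ r := (PiLp.norm_apply_le x i).trans (hT x hx)
    have hm : |x i * d / ρ| ≤ m := by
      refine le_trans ?_ (Nat.le_ceil _)
      rw [abs_div, abs_mul, abs_of_pos hd', abs_of_pos hρ, mul_comm]
      gcongr
    rw [abs_le] at hm
    refine ⟨Int.le_floor.mpr (by push_cast; exact hm.1), ?_⟩
    have hfloor : (⌊x i * d / ρ⌋ : ℝ) ≤ m := (Int.floor_le _).trans hm.2
    exact_mod_cast hfloor
  have hcell : ∀ k, μ (T ∩ cell ⁻¹' {k}) ≤ ENNReal.ofReal a := by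
    refine fun k ↦ hsub _ inter_subset_left ?_
    rintro y ⟨-, hy⟩ z ⟨-, hz⟩
    rw [dist_eq_norm]
    have := EuclideanSpace.norm_le_card_mul_of_forall_abs_le (x := y - z) (a := ρ / d)
      (by positivity) fun i ↦ by
        have hfl : ⌊y i * d / ρ⌋ = ⌊z i * d / ρ⌋ := congrFun (hy.trans hz.symm) i
        have := Int.abs_sub_lt_one_of_floor_eq_floor hfl
        rw [← sub_div, ← sub_mul, abs_div, abs_mul, abs_of_pos hd', abs_of_pos hρ,
          div_lt_one hρ] at this
        rw [le_div_iff₀ hd']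
        exact this.le
    rwa [Fintype.card_fin, mul_div_cancel₀ _ hd'.ne'] at this
  have hcard : (F.card : ℝ) ≤ (2 * (d * r / ρ) + 3) ^ d := by
    have hm : (m : ℝ) ≤ d * r / ρ + 1 := (Nat.ceil_lt_add_one (by positivity)).le
    have : F.card = (2 * m + 1) ^ d := by
      simp only [F, Fintype.card_piFinset, Int.card_Icc, Finset.prod_const, Finset.card_univ,
        Fintype.card_fin]
      congr 1
      omega
    rw [this]
    push_cast
    exact pow_le_pow_left₀ (by positivity) (by linarith) d
  calc μ T ≤ ∑ k ∈ F, μ (T ∩ cell ⁻¹' {k}) :=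
        (measure_mono hcover).trans (measure_biUnion_finset_le _ _)
    _ ≤ F.card • ENNReal.ofReal a := Finset.sum_le_card_nsmul _ _ _ fun k _ ↦ hcell k
    _ = ENNReal.ofReal (F.card : ℝ) * ENNReal.ofReal a := by simp
    _ ≤ ENNReal.ofReal ((2 * (d * r / ρ) + 3) ^ d) * ENNReal.ofReal a := by gcongr
    _ = ENNReal.ofReal ((2 * (d * r / ρ) + 3) ^ d * a) :=
        (ENNReal.ofReal_mul (by positivity)).symm

/-- A piece of the zero set of `f` on which all secants make a definite angle with the gradient:
`f` has `M`-Lipschitz derivative on `B` and gradient of size at least `2 * M * ρ`. -/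
theorem hausdorffMeasure_zero_set_le {n : ℕ} {f : EuclideanSpace ℝ (Fin (n + 1)) → ℝ}
    {B S : Set (EuclideanSpace ℝ (Fin (n + 1)))} {M : NNReal} {ρ : ℝ}
    (hf : Differentiable ℝ f) (hB : Convex ℝ B) (hM : LipschitzOnWith M (fderiv ℝ f) B)
    (hSB : S ⊆ B) (hzero : ∀ x ∈ S, f x = 0) (hcrit : ∀ x ∈ S, gradient f x ≠ 0) (hρ : 0 ≤ ρ)
    (hgrad : ∀ x ∈ S, 2 * (M * ρ) ≤ ‖gradient f x‖) (hS : ∀ y ∈ S, ∀ z ∈ S, dist y z ≤ ρ) :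
    μH[(n : ℝ)] S ≤ ENNReal.ofReal ((4 * n) ^ n * ρ ^ n) := by
  rcases S.eq_empty_or_nonempty with rfl | ⟨x, hx⟩
  · simp
  refine hausdorffMeasure_le_of_abs_inner_secant_le (hcrit x hx) hρ hS fun y hy z hz ↦ ?_
  have hmem : ∀ w ∈ S, w ∈ B ∩ closedBall x ρ := fun w hw ↦ ⟨hSB hw, hS w hw x hx⟩
  have hmvt := (hB.inter (convex_closedBall x ρ)).norm_image_sub_le_of_norm_fderiv_le'
    (f := f) (φ := fderiv ℝ f x) (C := M * ρ) (fun w _ ↦ hf w) (fun w hw ↦ by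
      rw [← dist_eq_norm]
      exact (hM.dist_le_mul w hw.1 x (hSB hx)).trans
        (mul_le_mul_of_nonneg_left hw.2 M.coe_nonneg)) (hmem z hz) (hmem y hy)
  rw [hzero y hy, hzero z hz, sub_zero, zero_sub, norm_neg, Real.norm_eq_abs] at hmvt
  have hinner : inner ℝ (gradient f x) (y - z) = fderiv ℝ f x (y - z) := by
    simp [gradient]
  rw [hinner]
  refine hmvt.trans (mul_le_mul_of_nonneg_right ?_ (norm_nonneg _))
  linarith [hgrad x hx]

/-- The part of the zero set of `Ω` in the shell `r / 2 ≤ ‖x‖ ≤ r` has measure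
`O (r ^ (dim - q))`. -/
theorem exists_hausdorffMeasure_zero_set_shell_le {n : ℕ} {q : ℝ} (hq : 1 ≤ q)
    {D : Set (EuclideanSpace ℝ (Fin (n + 1)))} (hDball : D ⊆ ball 0 1)
    {Ω : EuclideanSpace ℝ (Fin (n + 1)) → ℝ} (hΩ : ContDiff ℝ 2 Ω)
    {c : ℝ} (hc : 0 < c) (hgrad : ∀ x ∈ D, c * ‖x‖ ^ q ≤ ‖gradient Ω x‖) :
    ∃ C > 0, ∀ r ∈ Ioc (0 : ℝ) 1,
      μH[(n : ℝ)] {x ∈ D | Ω x = 0 ∧ r / 2 ≤ ‖x‖ ∧ ‖x‖ ≤ r} ≤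
        ENNReal.ofReal (C * r ^ ((n + 1 : ℝ) - q)) := by
  obtain ⟨M, hM⟩ := (hΩ.fderiv_right (m := 1) (by norm_num)).contDiffOn.exists_lipschitzOnWith
    one_ne_zero (convex_closedBall (0 : EuclideanSpace ℝ (Fin (n + 1))) 1) (isCompact_closedBall 0 1)
  have hM1 : (0 : ℝ) < M + 1 := by positivity
  set ε : ℝ := c / 2 ^ q / (2 * (M + 1)) with hε
  have hε0 : 0 < ε := by positivity
  have hεM : 2 * (M + 1) * ε = c / 2 ^ q := by rw [hε]; field_simp
  refine ⟨(2 * ((n + 1) / ε) + 3) ^ (n + 1) * ((4 * (n + 1)) ^ n * ε ^ n), by positivity,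
    fun r ⟨hr0, hr1⟩ ↦ ?_⟩
  set T := {x ∈ D | Ω x = 0 ∧ r / 2 ≤ ‖x‖ ∧ ‖x‖ ≤ r}
  have hρ : 0 < ε * r ^ q := by positivity
  have hlow : ∀ x ∈ T, 2 * (M + 1) * (ε * r ^ q) ≤ ‖gradient Ω x‖ := fun x hx ↦ by
    refine le_trans ?_ (hgrad x hx.1)
    rw [← mul_assoc, hεM, div_mul_eq_mul_div, mul_div_assoc, ← Real.div_rpow hr0.le zero_le_two]
    gcongr
    exact hx.2.2.1
  have hpiece : ∀ S ⊆ T, (∀ y ∈ S, ∀ z ∈ S, dist y z ≤ ε * r ^ q) →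
      μH[(n : ℝ)] S ≤ ENNReal.ofReal ((4 * n) ^ n * (ε * r ^ q) ^ n) := fun S hST hS ↦ by
    refine hausdorffMeasure_zero_set_le (hΩ.differentiable (by norm_num))
      (convex_closedBall 0 1) hM
      (fun x hx ↦ ball_subset_closedBall (hDball (hST hx).1)) (fun x hx ↦ (hST hx).2.1)
      (fun x hx ↦ norm_pos_iff.mp (lt_of_lt_of_le (by positivity) (hlow x (hST hx))))
      hρ.le (fun x hx ↦ le_trans ?_ (hlow x (hST hx))) hS
    nlinarith
  refine (measure_le_of_forall_subset_dist_le n.succ_ne_zero _ hr0.le hρ (fun x hx ↦ hx.2.2.2)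
    hpiece).trans (ENNReal.ofReal_le_ofReal ?_)
  have hpow : r / r ^ q = r ^ (1 - q) := by rw [Real.rpow_sub hr0, Real.rpow_one]
  have hone : 1 ≤ r ^ (1 - q) := Real.one_le_rpow_of_pos_of_le_one_of_nonpos hr0 hr1 (by linarith)
  have hcount : 2 * (((n + 1 : ℕ) : ℝ) * r / (ε * r ^ q)) + 3 ≤
      (2 * ((n + 1) / ε) + 3) * r ^ (1 - q) := by
    rw [mul_div_mul_comm, hpow]
    push_cast
    nlinarith
  have hexp : r ^ ((n + 1 : ℝ) - q) = (r ^ (1 - q)) ^ (n + 1) * (r ^ q) ^ n := by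
    rw [← Real.rpow_natCast, ← Real.rpow_natCast, ← Real.rpow_mul hr0.le, ← Real.rpow_mul hr0.le,
      ← Real.rpow_add hr0]
    push_cast
    ring_nf
  calc (2 * (((n + 1 : ℕ) : ℝ) * r / (ε * r ^ q)) + 3) ^ (n + 1) *
        ((4 * n) ^ n * (ε * r ^ q) ^ n)
      ≤ ((2 * ((n + 1) / ε) + 3) * r ^ (1 - q)) ^ (n + 1) *
        ((4 * (n + 1)) ^ n * (ε * r ^ q) ^ n) := by
        gcongr
        linarith
    _ = _ := by rw [hexp, mul_pow, mul_pow]; ring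

/-- A weighted version of a bound on dyadic shells. -/
theorem exists_setLIntegral_norm_rpow_shell_le {E : Type*} [NormedAddCommGroup E]
    [MeasurableSpace E] (μ : Measure E) (T : Set E) {C s : ℝ} (hC : 0 < C)
    (hT : ∀ r ∈ Ioc (0 : ℝ) 1, μ {x ∈ T | r / 2 ≤ ‖x‖ ∧ ‖x‖ ≤ r} ≤ ENNReal.ofReal (C * r ^ s))
    (p : ℝ) :
    ∃ C' > 0, ∀ r ∈ Ioc (0 : ℝ) 1,
      ∫⁻ x in {x ∈ T | r / 2 ≤ ‖x‖ ∧ ‖x‖ ≤ r}, ENNReal.ofReal (‖x‖ ^ (-p)) ∂μ ≤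
        ENNReal.ofReal (C' * r ^ (s - p)) := by
  refine ⟨2 ^ |p| * C, by positivity, fun r ⟨hr0, hr1⟩ ↦ ?_⟩
  have hle : ∀ x ∈ {x ∈ T | r / 2 ≤ ‖x‖ ∧ ‖x‖ ≤ r}, ‖x‖ ^ (-p) ≤ 2 ^ |p| * r ^ (-p) := by
    rintro x ⟨-, hx1, hx2⟩
    rcases le_total 0 p with hp | hp
    · calc ‖x‖ ^ (-p) ≤ (r / 2) ^ (-p) :=
            Real.rpow_le_rpow_of_nonpos (by positivity) hx1 (by linarith)
        _ = 2 ^ |p| * r ^ (-p) := by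
            rw [Real.div_rpow hr0.le zero_le_two, Real.rpow_neg zero_le_two, abs_of_nonneg hp,
              div_inv_eq_mul, mul_comm]
    · calc ‖x‖ ^ (-p) ≤ r ^ (-p) := Real.rpow_le_rpow (norm_nonneg _) hx2 (by linarith)
        _ ≤ 2 ^ |p| * r ^ (-p) :=
            le_mul_of_one_le_left (by positivity) (Real.one_le_rpow one_le_two (abs_nonneg p))
  calc ∫⁻ x in {x ∈ T | r / 2 ≤ ‖x‖ ∧ ‖x‖ ≤ r}, ENNReal.ofReal (‖x‖ ^ (-p)) ∂μ
      ≤ ∫⁻ _ in {x ∈ T | r / 2 ≤ ‖x‖ ∧ ‖x‖ ≤ r}, ENNReal.ofReal (2 ^ |p| * r ^ (-p)) ∂μ :=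
        setLIntegral_mono measurable_const fun x hx ↦ ENNReal.ofReal_le_ofReal (hle x hx)
    _ = ENNReal.ofReal (2 ^ |p| * r ^ (-p)) * μ {x ∈ T | r / 2 ≤ ‖x‖ ∧ ‖x‖ ≤ r} :=
        setLIntegral_const _ _
    _ ≤ ENNReal.ofReal (2 ^ |p| * r ^ (-p)) * ENNReal.ofReal (C * r ^ s) := by
        gcongr
        exact hT r ⟨hr0, hr1⟩
    _ = ENNReal.ofReal (2 ^ |p| * C * r ^ (s - p)) := by
        rw [← ENNReal.ofReal_mul (by positivity), sub_eq_neg_add, Real.rpow_add hr0]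
        congr 1
        ring

theorem exists_dyadic_shell {t : ℝ} (h0 : 0 < t) (h1 : t ≤ 1) :
    ∃ k : ℕ, (1 / 2 : ℝ) ^ k / 2 ≤ t ∧ t ≤ (1 / 2) ^ k := by
  obtain ⟨k, hk1, hk2⟩ := exists_nat_pow_near_of_lt_one (y := (1 / 2 : ℝ)) h0 h1 (by norm_num)
    (by norm_num)
  exact ⟨k, by rw [pow_succ] at hk1; linarith, hk2⟩

/-- Summation of power bounds over dyadic shells. -/
theorem exists_setLIntegral_compl_ball_le {E : Type*} [NormedAddCommGroup E]
    [MeasurableSpace E] (μ : Measure E) {T : Set E} (hT : ∀ x ∈ T, ‖x‖ ≤ 1) (f : E → ENNReal)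
    {C s : ℝ} (hC : 0 < C) (hs : 0 ≤ s)
    (hshell : ∀ r ∈ Ioc (0 : ℝ) 1,
      ∫⁻ x in {x ∈ T | r / 2 ≤ ‖x‖ ∧ ‖x‖ ≤ r}, f x ∂μ ≤ ENNReal.ofReal (C * r ^ s)) :
    ∃ C' > 0, ∀ δ ∈ Ioc (0 : ℝ) (1 / 2),
      ∫⁻ x in T \ ball 0 δ, f x ∂μ ≤ ENNReal.ofReal (C' * if s = 0 then |Real.log δ| else 1) := by
  set A : ℕ → Set E := fun k ↦ {x ∈ T | (1 / 2 : ℝ) ^ k / 2 ≤ ‖x‖ ∧ ‖x‖ ≤ (1 / 2) ^ k}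
  have hA : ∀ k, ∫⁻ x in A k, f x ∂μ ≤ ENNReal.ofReal (C * ((1 / 2 : ℝ) ^ k) ^ s) := fun k ↦
    hshell _ ⟨by positivity, pow_le_one₀ (by norm_num) (by norm_num)⟩
  have hmem : ∀ δ > 0, ∀ x ∈ T \ ball 0 δ, δ ≤ ‖x‖ ∧ ∃ k, x ∈ A k := fun δ hδ x hx ↦ by
    have hδx : δ ≤ ‖x‖ := by simpa using hx.2
    obtain ⟨k, hk⟩ := exists_dyadic_shell (hδ.trans_le hδx) (hT x hx.1)
    exact ⟨hδx, k, hx.1, hk⟩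
  rcases hs.eq_or_lt with rfl | hs
  · have hlog : 0 < Real.log 2 := Real.log_pos one_lt_two
    refine ⟨C * (2 / Real.log 2), by positivity, fun δ ⟨hδ0, hδ1⟩ ↦ ?_⟩
    set N := ⌊|Real.log δ| / Real.log 2⌋₊ + 1
    have hδlog : Real.log 2 ≤ |Real.log δ| := by
      have := Real.log_le_log hδ0 hδ1
      rw [one_div, Real.log_inv] at this
      rw [abs_of_neg (by linarith)]
      linarith
    have hN : (N : ℝ) ≤ 2 / Real.log 2 * |Real.log δ| := by
      have h1 : (1 : ℝ) ≤ |Real.log δ| / Real.log 2 := (one_le_div hlog).mpr hδlog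
      have h2 := Nat.floor_le (zero_le_one.trans h1)
      have h3 : 2 / Real.log 2 * |Real.log δ| = 2 * (|Real.log δ| / Real.log 2) := by ring
      rw [h3]
      push_cast [N]
      linarith
    have hcover : T \ ball 0 δ ⊆ ⋃ k : Fin N, A k := fun x hx ↦ by
      obtain ⟨hδx, k, hk⟩ := hmem δ hδ0 x hx
      refine mem_iUnion.mpr ⟨⟨k, Nat.lt_succ_of_le (Nat.le_floor ?_)⟩, hk⟩
      rw [le_div_iff₀ hlog]
      have := Real.log_le_log hδ0 (hδx.trans hk.2.2)
      rw [one_div, Real.log_pow, Real.log_inv] at this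
      linarith [neg_le_abs (Real.log δ)]
    calc ∫⁻ x in T \ ball 0 δ, f x ∂μ ≤ ∑' k : Fin N, ∫⁻ x in A k, f x ∂μ :=
          (lintegral_mono_set hcover).trans (lintegral_iUnion_le _ _)
      _ ≤ ∑' _ : Fin N, ENNReal.ofReal C :=
          ENNReal.tsum_le_tsum fun k ↦ by simpa using hA k
      _ = ENNReal.ofReal (N * C) := by
          rw [ENNReal.ofReal_mul (by positivity)]
          simp
      _ ≤ _ := by
          rw [if_pos rfl]
          refine ENNReal.ofReal_le_ofReal ?_
          nlinarith
  · have hgeom : ∀ k : ℕ, ((1 / 2 : ℝ) ^ k) ^ s = ((1 / 2) ^ s) ^ k := fun k ↦ by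
      rw [← Real.rpow_natCast, ← Real.rpow_natCast, ← Real.rpow_mul (by norm_num),
        ← Real.rpow_mul (by norm_num), mul_comm]
    have hsum : Summable fun k : ℕ ↦ C * ((1 / 2 : ℝ) ^ k) ^ s := by
      simp_rw [hgeom]
      exact (summable_geometric_of_lt_one (by positivity)
        (Real.rpow_lt_one (by norm_num) (by norm_num) hs)).mul_left C
    refine ⟨∑' k : ℕ, C * ((1 / 2 : ℝ) ^ k) ^ s,
      hsum.tsum_pos (fun k ↦ by positivity) 0 (by positivity), fun δ ⟨hδ0, _⟩ ↦ ?_⟩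
    have hcover : T \ ball 0 δ ⊆ ⋃ k, A k := fun x hx ↦ mem_iUnion.mpr (hmem δ hδ0 x hx).2
    calc ∫⁻ x in T \ ball 0 δ, f x ∂μ ≤ ∑' k, ∫⁻ x in A k, f x ∂μ :=
          (lintegral_mono_set hcover).trans (lintegral_iUnion_le _ _)
      _ ≤ ∑' k : ℕ, ENNReal.ofReal (C * ((1 / 2 : ℝ) ^ k) ^ s) := ENNReal.tsum_le_tsum hA
      _ = _ := by
          rw [if_neg hs.ne', mul_one, ENNReal.ofReal_tsum_of_nonneg (fun k ↦ by positivity) hsum]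

/-- Let `p ≤ d − q`. Then there is `C > 0` such that for every `δ ∈ (0, 1/2]`,
`∫_{Σ₀ \ B_δ} |x|^{-p} dH^{d-1}(x) ≤ C χ_{d, p+q}(δ)`, where
`χ_{a,b}(r) = 1` if `a ≠ b` and `|ln r|` if `a = b`. -/
theorem integral_over_sigma_outside_ball {d : ℕ} (q : ℝ) (hq : 1 ≤ q)
    (D : Set (EuclideanSpace ℝ (Fin d))) (hD : IsOpen D) (hDball : D ⊆ ball 0 1)
    (Ω : EuclideanSpace ℝ (Fin d) → ℝ) (hΩ : ContDiff ℝ 5 Ω)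
    (h0D : (0 : EuclideanSpace ℝ (Fin d)) ∈ D) (hΩ0 : Ω 0 = 0)
    (hcrit0 : gradient Ω 0 = 0)
    (hcrit : ∀ x ∈ D, Ω x = 0 → gradient Ω x = 0 → x = 0)
    (c : ℝ) (hc : 0 < c)
    (hgrad : ∀ x ∈ D, c * ‖x‖ ^ q ≤ ‖gradient Ω x‖)
    (p : ℝ) (hp : p ≤ (d : ℝ) - q) :
    ∃ C > 0, ∀ δ ∈ Set.Ioc (0 : ℝ) (1 / 2),
      ∫⁻ x in (({y ∈ D | Ω y = 0} \ {0}) \ ball 0 δ),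
          ENNReal.ofReal (‖x‖ ^ (-p)) ∂(μH[(d : ℝ) - 1]) ≤
        ENNReal.ofReal (C * (if (d : ℝ) = p + q then |Real.log δ| else 1)) := by
  rcases d with _ | n
  · refine ⟨1, one_pos, fun δ _ ↦ ?_⟩
    have hempty : ({y ∈ D | Ω y = 0} \ {0}) \ ball 0 δ = ∅ :=
      eq_empty_of_forall_notMem fun x hx ↦ hx.1.2 (Subsingleton.elim x 0)
    rw [hempty, Measure.restrict_empty, lintegral_zero_measure]
    exact zero_le
  have hdim : ((n + 1 : ℕ) : ℝ) - 1 = n := by push_cast; ring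
  set T := {y ∈ D | Ω y = 0} \ {0}
  obtain ⟨C₁, hC₁, hmeas⟩ := exists_hausdorffMeasure_zero_set_shell_le hq hDball
    (hΩ.of_le (by norm_num)) hc hgrad
  obtain ⟨C₂, hC₂, hshell⟩ := exists_setLIntegral_norm_rpow_shell_le μH[(n : ℝ)] T hC₁
    (fun r hr ↦ (hmeas r hr).trans' (measure_mono fun _ hx ↦ ⟨hx.1.1.1, hx.1.1.2, hx.2⟩)) p
  obtain ⟨C, hC, hbound⟩ := exists_setLIntegral_compl_ball_le μH[(n : ℝ)]
    (fun x hx ↦ (mem_ball_zero_iff.mp (hDball hx.1.1)).le) _ hC₂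
    (by push_cast at hp; linarith) hshell
  refine ⟨C, hC, fun δ hδ ↦ ?_⟩
  have hiff : ((n + 1 : ℕ) : ℝ) = p + q ↔ (n + 1 : ℝ) - q - p = 0 := by
    push_cast
    constructor <;> intro h <;> linarith
  rw [hdim, if_congr hiff rfl rfl]
  exact hbound δ hδ
end

section
/- For every $p < d - q$, the integral $\int_{\Sigma_0} |x|^{-p}\, d\mathcal{H}^{d-1}(x)$ is finite. -/
open MeasureTheory Metric Real Set

theorem lintegral_norm_rpow_ball_lt_top {E : Type*} [NormedAddCommGroup E] [NormedSpace ℝ E]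
    [FiniteDimensional ℝ E] [Nontrivial E] [MeasurableSpace E] [BorelSpace E]
    (μ : Measure E) [μ.IsAddHaarMeasure] {s r : ℝ} (hr : 0 < r)
    (hs : -(Module.finrank ℝ E : ℝ) < s) :
    ∫⁻ x in ball (0 : E) r, ENNReal.ofReal (‖x‖ ^ s) ∂μ < ⊤ := by
  have hint : IntegrableOn (fun x : E => ‖x‖ ^ s) (ball (0 : E) r) μ := by
    rw [integrableOn_fun_norm_addHaar μ (f := fun t : ℝ => t ^ s)]
    have h := (intervalIntegral.integrableOn_Ioo_rpow_iff
      (s := (Module.finrank ℝ E : ℝ) - 1 + s) hr).2 (by linarith)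
    refine h.congr_fun (fun t ht => ?_) measurableSet_Ioo
    have h1 : 1 ≤ Module.finrank ℝ E := Module.finrank_pos
    simp only [smul_eq_mul]
    rw [rpow_add ht.1, ← Nat.cast_one, ← Nat.cast_sub h1, rpow_natCast]
  exact hint.lintegral_lt_top

theorem rpow_le_two_rpow_abs_mul {u v : ℝ} (a : ℝ) (hu : 0 < u) (hv : 0 < v)
    (huv : u ≤ 2 * v) (hvu : v ≤ 2 * u) : u ^ a ≤ 2 ^ |a| * v ^ a := by
  rcases le_total 0 a with ha | ha
  · rw [abs_of_nonneg ha, ← mul_rpow (by norm_num) hv.le]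
    exact rpow_le_rpow hu.le huv ha
  · rw [abs_of_nonpos ha, rpow_neg (by norm_num), ← inv_rpow (by norm_num),
      ← mul_rpow (by norm_num) hv.le]
    exact rpow_le_rpow_of_nonpos (by positivity) (by linarith) ha

/-- A nonzero vector `g` has a norm-nonincreasing linear map to Euclidean space of one dimension
less which is bounded below away from the direction of `g`. -/
theorem exists_clm_norm_le_of_inner {E : Type*} [NormedAddCommGroup E] [InnerProductSpace ℝ E]
    {n : ℕ} (hn : Module.finrank ℝ E = n + 1) {g : E} (hg : g ≠ 0) :
    ∃ L : E →L[ℝ] EuclideanSpace ℝ (Fin n), (∀ v, ‖L v‖ ≤ ‖v‖) ∧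
      ∀ v, ‖v‖ ≤ ‖L v‖ + |inner ℝ g v| / ‖g‖ := by
  have : Fact (Module.finrank ℝ E = n + 1) := ⟨hn⟩
  have : FiniteDimensional ℝ E := .of_fact_finrank_eq_succ n
  let b := OrthonormalBasis.fromOrthogonalSpanSingleton (𝕜 := ℝ) n hg
  let P := (ℝ ∙ g)ᗮ.orthogonalProjectionOnto
  refine ⟨b.repr.toContinuousLinearEquiv.toContinuousLinearMap ∘L P, fun v => ?_, fun v => ?_⟩
  · refine le_trans (le_of_eq ?_) ((ℝ ∙ g)ᗮ.norm_orthogonalProjectionOnto_apply_le v)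
    simp [P]
  · have h1 : ‖(b.repr.toContinuousLinearEquiv.toContinuousLinearMap ∘L P) v‖
        = ‖(ℝ ∙ g)ᗮ.starProjection v‖ := by
      simp [P]
    have h2 : ‖(ℝ ∙ g).starProjection v‖ = |inner ℝ g v| / ‖g‖ := by
      rw [Submodule.starProjection_singleton, norm_smul, Real.norm_eq_abs, abs_div]
      have : ‖g‖ ≠ 0 := norm_ne_zero_iff.2 hg
      simp
      field_simp
    rw [h1, ← h2]
    have h3 := (ℝ ∙ g).starProjection_add_starProjection_orthogonal v
    calc ‖v‖ = ‖(ℝ ∙ g).starProjection v + (ℝ ∙ g)ᗮ.starProjection v‖ := by rw [h3]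
      _ ≤ _ := by rw [add_comm]; exact norm_add_le _ _

/-- A bounded set all of whose secants make an angle bounded below with a fixed direction has
`n`-dimensional Hausdorff measure controlled by the `n`-th power of its radius. -/
theorem hausdorffMeasure_le_of_inner_le {E : Type*} [NormedAddCommGroup E] [InnerProductSpace ℝ E]
    [MeasurableSpace E] [BorelSpace E]
    {n : ℕ} (hn : Module.finrank ℝ E = n + 1) {g : E} (hg : g ≠ 0) {S : Set E} {x₀ : E} {R : ℝ}
    (hR : 0 ≤ R) (hS : S ⊆ closedBall x₀ R)
    (hinner : ∀ y ∈ S, ∀ z ∈ S, |inner ℝ g (y - z)| ≤ ‖g‖ / 2 * ‖y - z‖) :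
    μH[n] S ≤ 2 ^ n * μH[n] (closedBall (0 : EuclideanSpace ℝ (Fin n)) 1) *
      ENNReal.ofReal (R ^ n) := by
  obtain ⟨L, hL, hLb⟩ := exists_clm_norm_le_of_inner hn hg
  have hg0 : 0 < ‖g‖ := norm_pos_iff.2 hg
  have hanti : AntilipschitzWith 2 (fun y : S => L y) := by
    refine AntilipschitzWith.of_le_mul_dist fun y z => ?_
    have h1 := hLb (y - z)
    have h2 : |inner ℝ g ((y : E) - z)| / ‖g‖ ≤ ‖(y : E) - z‖ / 2 := by
      rw [div_le_iff₀ hg0]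
      linarith [hinner y y.2 z z.2]
    rw [Subtype.dist_eq, dist_eq_norm, dist_eq_norm, ← map_sub]
    push_cast
    linarith
  have hball : μH[n] (closedBall (L x₀) R) = ENNReal.ofReal (R ^ n) *
      μH[n] (closedBall (0 : EuclideanSpace ℝ (Fin n)) 1) := by
    have hH := isAddHaarMeasure_hausdorffMeasure (E := EuclideanSpace ℝ (Fin n))
    have := @Measure.addHaar_closedBall' (EuclideanSpace ℝ (Fin n)) _ _ _ _ _ _ hH (L x₀) R hR
    rwa [finrank_euclideanSpace_fin] at this
  calc μH[n] S = μH[n] (Subtype.val '' (univ : Set S)) := by simp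
    _ = μH[n] (univ : Set S) := isometry_subtype_coe.hausdorffMeasure_image (.inl n.cast_nonneg) _
    _ ≤ μH[n] ((fun y : S => L y) ⁻¹' closedBall (L x₀) R) := by
        refine measure_mono fun y _ => ?_
        rw [mem_preimage, mem_closedBall, dist_eq_norm, ← map_sub]
        exact (hL _).trans (by simpa [dist_eq_norm] using hS y.2)
    _ ≤ (2 : ENNReal) ^ (n : ℝ) * μH[n] (closedBall (L x₀) R) := by
        simpa using hanti.hausdorffMeasure_preimage_le n.cast_nonneg (closedBall (L x₀) R)
    _ = _ := by rw [hball, ENNReal.rpow_natCast]; ring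

theorem hausdorffMeasure_closedBall_lt_top (n : ℕ) (r : ℝ) :
    μH[n] (closedBall (0 : EuclideanSpace ℝ (Fin n)) r) < ⊤ := by
  have hH := isAddHaarMeasure_hausdorffMeasure (E := EuclideanSpace ℝ (Fin n))
  rw [finrank_euclideanSpace_fin] at hH
  exact (isCompact_closedBall _ _).measure_lt_top

/-- Near a regular point, at scales small compared to the size of the gradient, the zero set of a
`C²` function has codimension-one Hausdorff measure at most that of a flat disc, up to a constant. -/
theorem exists_hausdorffMeasure_zeroSet_inter_closedBall_le {E : Type*} [NormedAddCommGroup E]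
    [InnerProductSpace ℝ E] [CompleteSpace E] [MeasurableSpace E] [BorelSpace E]
    {n : ℕ} (hn : Module.finrank ℝ E = n + 1)
    {f : E → ℝ} (hf : ContDiff ℝ 2 f) {S : Set E} (hSball : S ⊆ ball 0 1)
    (hS : ∀ x ∈ S, f x = 0) :
    ∃ η > 0, ∃ C < (⊤ : ENNReal), ∀ x ∈ S, gradient f x ≠ 0 → ∀ R, 0 ≤ R →
      R ≤ η * ‖gradient f x‖ → μH[n] (S ∩ closedBall x R) ≤ C * ENNReal.ofReal (R ^ n) := by
  have : Fact (Module.finrank ℝ E = n + 1) := ⟨hn⟩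
  have : FiniteDimensional ℝ E := .of_fact_finrank_eq_succ n
  have hfd : ContDiff ℝ 1 (fderiv ℝ f) := hf.fderiv_right (by norm_num)
  obtain ⟨K, hK⟩ := hfd.contDiffOn.exists_lipschitzOnWith (s := closedBall (0 : E) 1) one_ne_zero
    (convex_closedBall _ _) (isCompact_closedBall _ _)
  refine ⟨1 / (2 * (K + 1)), by positivity,
    2 ^ n * μH[n] (closedBall (0 : EuclideanSpace ℝ (Fin n)) 1),
    ENNReal.mul_lt_top (by simp) (hausdorffMeasure_closedBall_lt_top n 1),
    fun x hx hg R hR hRη => ?_⟩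
  refine hausdorffMeasure_le_of_inner_le hn hg hR inter_subset_right fun y hy z hz => ?_
  have hb : ∀ w ∈ S, w ∈ closedBall (0 : E) 1 := fun w hw => ball_subset_closedBall (hSball hw)
  have hKR : K * R ≤ ‖gradient f x‖ / 2 := by
    have h1 : (0 : ℝ) < K + 1 := by positivity
    calc (K : ℝ) * R ≤ (K + 1) * R := by gcongr; linarith
      _ ≤ (K + 1) * (1 / (2 * (K + 1)) * ‖gradient f x‖) := by gcongr
      _ = _ := by field_simp
  have key := ((convex_closedBall (0 : E) 1).inter
      (convex_closedBall x R)).norm_image_sub_le_of_norm_fderiv_le'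
    (f := f) (𝕜 := ℝ) (φ := fderiv ℝ f x) (C := ‖gradient f x‖ / 2)
    (fun w _ => hf.differentiable (by norm_num) w) (fun w hw => ?_)
    ⟨hb z hz.1, hz.2⟩ ⟨hb y hy.1, hy.2⟩
  · rw [hS y hy.1, hS z hz.1, sub_zero, zero_sub, norm_neg, Real.norm_eq_abs] at key
    rwa [gradient, InnerProductSpace.toDual_symm_apply]
  · rw [← dist_eq_norm]
    refine (hK.dist_le_mul w hw.1 x (hb x hx)).trans (le_trans ?_ hKR)
    gcongr
    exact hw.2

/-- If on each ball around `x ∈ S` of radius `R ≤ η ‖x‖ ^ q` the set `S` has `ν`-measure at most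
`C R ^ n`, in ambient dimension `n + 1`, then `‖x‖ ^ (-p)` has finite `ν`-integral over `S` for
`p < n + 1 - q`. -/
theorem lintegral_norm_rpow_lt_top_of_measure_inter_closedBall_le {E : Type*}
    [NormedAddCommGroup E] [NormedSpace ℝ E] [MeasurableSpace E] [BorelSpace E]
    {n : ℕ} (hn : Module.finrank ℝ E = n + 1) (ν : Measure E) {S : Set E} (hSm : MeasurableSet S)
    (hSball : S ⊆ ball 0 1) (hS0 : 0 ∉ S) {q η : ℝ} (hq : 1 ≤ q) (hη : 0 < η) {C : ENNReal}
    (hC : C < ⊤)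
    (hν : ∀ x ∈ S, ∀ R, 0 ≤ R → R ≤ η * ‖x‖ ^ q →
      ν (S ∩ closedBall x R) ≤ C * ENNReal.ofReal (R ^ n))
    {p : ℝ} (hp : p < (n + 1 : ℝ) - q) :
    ∫⁻ x in S, ENNReal.ofReal (‖x‖ ^ (-p)) ∂ν < ⊤ := by
  have : Fact (Module.finrank ℝ E = n + 1) := ⟨hn⟩
  have : FiniteDimensional ℝ E := .of_fact_finrank_eq_succ n
  have : Nontrivial E := Module.nontrivial_of_finrank_pos (R := ℝ) (by omega)
  have hpos : ∀ x ∈ S, 0 < ‖x‖ := fun x hx => norm_pos_iff.2 fun h => hS0 (h ▸ hx)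
  have hlt : ∀ x ∈ S, ‖x‖ < 1 := fun x hx => by simpa using hSball hx
  have hσ : SigmaFinite (ν.restrict S) := by
    obtain ⟨t, htS, htc, ht⟩ := TopologicalSpace.countable_cover_nhdsWithin
      (f := fun x => closedBall x (η * ‖x‖ ^ q)) (s := S) fun x hx =>
        mem_nhdsWithin_of_mem_nhds
          (closedBall_mem_nhds _ (mul_pos hη (rpow_pos_of_pos (hpos x hx) _)))
    refine Measure.sigmaFinite_of_countable
      (S := insert Sᶜ ((fun x => closedBall x (η * ‖x‖ ^ q)) '' t))
      ((htc.image _).insert _) ?_ ?_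
    · rintro _ (rfl | ⟨x, hx, rfl⟩)
      · simp [Measure.restrict_apply hSm.compl]
      · rw [Measure.restrict_apply measurableSet_closedBall, inter_comm]
        exact (hν x (htS hx) _ (by positivity) le_rfl).trans_lt
          (ENNReal.mul_lt_top hC ENNReal.ofReal_lt_top)
    · rw [sUnion_insert, sUnion_image]
      exact eq_univ_of_forall fun x => (em (x ∈ S)).elim (fun h => .inr (ht h)) .inl
  obtain ⟨δ, hδ, hδ4, hδη⟩ : ∃ δ : ℝ, 0 < δ ∧ δ ≤ 1 / 4 ∧ 2 * δ * 2 ^ q ≤ η := by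
    refine ⟨min (1 / 4) (η / (2 * 2 ^ q)), by positivity, min_le_left _ _, ?_⟩
    calc 2 * min (1 / 4) (η / (2 * 2 ^ q)) * 2 ^ q ≤ 2 * (η / (2 * 2 ^ q)) * 2 ^ q := by
          gcongr; exact min_le_right _ _
      _ = η := by field_simp
  have hnear : ∀ x ∈ S, ∀ y, dist y x < δ * ‖x‖ ^ q → 3 / 4 * ‖x‖ ≤ ‖y‖ ∧ ‖y‖ ≤ 5 / 4 * ‖x‖ := by
    intro x hx y hy
    have h1 : ‖x‖ ^ q ≤ ‖x‖ := by
      simpa using rpow_le_rpow_of_exponent_ge (hpos x hx) (hlt x hx).le hq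
    have h2 : ‖y - x‖ ≤ 1 / 4 * ‖x‖ := by
      rw [← dist_eq_norm]
      exact hy.le.trans (mul_le_mul hδ4 h1 (by positivity) (by norm_num))
    have h3 := norm_sub_norm_le x y
    have h4 := norm_sub_norm_le y x
    rw [norm_sub_rev] at h3
    constructor <;> linarith
  let μ : Measure E := Measure.addHaar
  set a : ℝ := -p - q * (n + 1) with ha
  let F : E → E → ENNReal := fun x y =>
    {z : E × E | dist z.2 z.1 < δ * ‖z.1‖ ^ q}.indicator
      (fun z => ENNReal.ofReal (‖z.2‖ ^ a)) (x, y)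
  have hU : MeasurableSet {z : E × E | dist z.2 z.1 < δ * ‖z.1‖ ^ q} := by
    refine (isOpen_lt (by fun_prop) ?_).measurableSet
    exact continuous_const.mul (continuous_fst.norm.rpow_const fun _ => .inr (by linarith))
  have hF : Measurable (Function.uncurry F) :=
    Measurable.indicator (by fun_prop) hU
  set K : ENNReal := ENNReal.ofReal ((2 ^ |a|)⁻¹ * δ ^ (n + 1)) * μ (ball 0 1) with hK
  have hK0 : K ≠ 0 := by
    refine mul_ne_zero ?_ (measure_ball_pos μ _ one_pos).ne'
    rw [Ne, ENNReal.ofReal_eq_zero, not_le]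
    positivity
  have hlower : ∀ x ∈ S, K * ENNReal.ofReal (‖x‖ ^ (-p)) ≤ ∫⁻ y, F x y ∂μ := by
    intro x hx
    have hx0 := hpos x hx
    have hxa : ‖x‖ ^ a * (‖x‖ ^ q) ^ (n + 1) = ‖x‖ ^ (-p) := by
      rw [← rpow_natCast, ← rpow_mul hx0.le, ← rpow_add hx0, ha]
      congr 1
      push_cast
      ring
    calc K * ENNReal.ofReal (‖x‖ ^ (-p))
        = ENNReal.ofReal ((2 ^ |a|)⁻¹ * ‖x‖ ^ a) * μ (ball x (δ * ‖x‖ ^ q)) := by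
          rw [Measure.addHaar_ball μ x (by positivity), hn, hK, mul_right_comm,
            ← ENNReal.ofReal_mul (by positivity), ← mul_assoc,
            ← ENNReal.ofReal_mul (by positivity), ← hxa, mul_pow]
          ring_nf
      _ = ∫⁻ _ in ball x (δ * ‖x‖ ^ q), ENNReal.ofReal ((2 ^ |a|)⁻¹ * ‖x‖ ^ a) ∂μ := by
          rw [setLIntegral_const]
      _ ≤ ∫⁻ y in ball x (δ * ‖x‖ ^ q), F x y ∂μ := by
          refine setLIntegral_mono' measurableSet_ball fun y hy => ?_
          obtain ⟨h1, h2⟩ := hnear x hx y hy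
          have hmem : (x, y) ∈ {z : E × E | dist z.2 z.1 < δ * ‖z.1‖ ^ q} := hy
          rw [show F x y = ENNReal.ofReal (‖y‖ ^ a) from indicator_of_mem hmem _]
          refine ENNReal.ofReal_le_ofReal ?_
          rw [inv_mul_le_iff₀ (by positivity)]
          exact rpow_le_two_rpow_abs_mul a hx0 (by linarith) (by linarith) (by linarith)
      _ ≤ ∫⁻ y, F x y ∂μ := setLIntegral_le_lintegral _ _
  set M : ENNReal := C * ENNReal.ofReal ((2 * δ * 2 ^ q * 2 ^ q) ^ n) with hM
  have hupper : ∀ y, ∫⁻ x in S, F x y ∂ν ≤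
      (ball (0 : E) 2).indicator (fun y => M * ENNReal.ofReal (‖y‖ ^ (-p - q))) y := by
    intro y
    let V : Set E := {x | dist y x < δ * ‖x‖ ^ q}
    have hV : MeasurableSet V := measurable_prodMk_right (y := y) hU
    have hFV : ∫⁻ x in S, F x y ∂ν = ENNReal.ofReal (‖y‖ ^ a) * ν (S ∩ V) := by
      rw [show (fun x => F x y) = V.indicator fun _ => ENNReal.ofReal (‖y‖ ^ a) from rfl,
        lintegral_indicator_const hV, Measure.restrict_apply hV, inter_comm]
    rw [hFV]
    rcases (S ∩ V).eq_empty_or_nonempty with h | ⟨x₀, hx₀, hx₀V⟩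
    · simp [h]
    obtain ⟨h1, h2⟩ := hnear x₀ hx₀ y hx₀V
    have hx₀0 := hpos x₀ hx₀
    have hy0 : 0 < ‖y‖ := by linarith
    have hy2 : y ∈ ball (0 : E) 2 := by
      rw [mem_ball_zero_iff]
      linarith [hlt x₀ hx₀]
    rw [indicator_of_mem hy2]
    have hsub : S ∩ V ⊆ S ∩ closedBall x₀ (2 * δ * 2 ^ q * ‖x₀‖ ^ q) := by
      rintro x ⟨hx, hxV⟩
      refine ⟨hx, ?_⟩
      have h3 := (hnear x hx y hxV).1
      have h4 : ‖x‖ ^ q ≤ 2 ^ q * ‖x₀‖ ^ q := by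
        rw [← mul_rpow (by norm_num) hx₀0.le]
        exact rpow_le_rpow (norm_nonneg _) (by linarith) (by linarith)
      have h5 : ‖x₀‖ ^ q ≤ 2 ^ q * ‖x₀‖ ^ q :=
        le_mul_of_one_le_left (by positivity) (one_le_rpow (by norm_num) (by linarith))
      have hxV' : dist y x < δ * ‖x‖ ^ q := hxV
      have hx₀V' : dist y x₀ < δ * ‖x₀‖ ^ q := hx₀V
      rw [mem_closedBall]
      calc dist x x₀ ≤ dist y x + dist y x₀ := dist_triangle_left _ _ _
        _ ≤ δ * ‖x‖ ^ q + δ * ‖x₀‖ ^ q := by linarith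
        _ ≤ δ * (2 ^ q * ‖x₀‖ ^ q) + δ * (2 ^ q * ‖x₀‖ ^ q) := by gcongr
        _ = _ := by ring
    have hR : 2 * δ * 2 ^ q * ‖x₀‖ ^ q ≤ 2 * δ * 2 ^ q * 2 ^ q * ‖y‖ ^ q := by
      rw [mul_assoc _ _ (‖y‖ ^ q), ← mul_rpow (by norm_num) hy0.le]
      gcongr
      linarith
    have hya : ‖y‖ ^ a * (‖y‖ ^ q) ^ n = ‖y‖ ^ (-p - q) := by
      rw [← rpow_natCast, ← rpow_mul hy0.le, ← rpow_add hy0, ha]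
      congr 1
      ring
    calc ENNReal.ofReal (‖y‖ ^ a) * ν (S ∩ V)
        ≤ ENNReal.ofReal (‖y‖ ^ a) *
          (C * ENNReal.ofReal ((2 * δ * 2 ^ q * 2 ^ q * ‖y‖ ^ q) ^ n)) := by
          gcongr
          refine (measure_mono hsub).trans ((hν x₀ hx₀ _ (by positivity) (by gcongr)).trans ?_)
          gcongr
      _ = M * ENNReal.ofReal (‖y‖ ^ (-p - q)) := by
          rw [← hya, mul_pow, hM, ENNReal.ofReal_mul (by positivity),
            ENNReal.ofReal_mul (by positivity)]
          ring
  have hfin : K * ∫⁻ x in S, ENNReal.ofReal (‖x‖ ^ (-p)) ∂ν < ⊤ := by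
    calc K * ∫⁻ x in S, ENNReal.ofReal (‖x‖ ^ (-p)) ∂ν
        = ∫⁻ x in S, K * ENNReal.ofReal (‖x‖ ^ (-p)) ∂ν := by
          rw [lintegral_const_mul _ (by fun_prop)]
      _ ≤ ∫⁻ x in S, ∫⁻ y, F x y ∂μ ∂ν := setLIntegral_mono' hSm hlower
      _ = ∫⁻ y, ∫⁻ x in S, F x y ∂ν ∂μ := lintegral_lintegral_swap hF.aemeasurable
      _ ≤ ∫⁻ y, (ball (0 : E) 2).indicator
            (fun y => M * ENNReal.ofReal (‖y‖ ^ (-p - q))) y ∂μ := lintegral_mono hupper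
      _ = M * ∫⁻ y in ball (0 : E) 2, ENNReal.ofReal (‖y‖ ^ (-p - q)) ∂μ := by
          rw [lintegral_indicator measurableSet_ball, lintegral_const_mul _ (by fun_prop)]
      _ < ⊤ := by
          refine ENNReal.mul_lt_top (ENNReal.mul_lt_top hC ENNReal.ofReal_lt_top)
            (lintegral_norm_rpow_ball_lt_top μ two_pos ?_)
          rw [hn]
          push_cast
          linarith
  exact ENNReal.lt_top_of_mul_ne_top_right hfin.ne hK0

/-- For every `p < d − q`, the integral `∫_{Σ₀} |x|^{-p} dH^{d-1}(x)` is finite. -/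
theorem integral_over_sigma_finite {d : ℕ} (q : ℝ) (hq : 1 ≤ q)
    (D : Set (EuclideanSpace ℝ (Fin d))) (hD : IsOpen D) (hDball : D ⊆ ball 0 1)
    (Ω : EuclideanSpace ℝ (Fin d) → ℝ) (hΩ : ContDiff ℝ 5 Ω)
    (h0D : (0 : EuclideanSpace ℝ (Fin d)) ∈ D) (hΩ0 : Ω 0 = 0)
    (hcrit0 : gradient Ω 0 = 0)
    (hcrit : ∀ x ∈ D, Ω x = 0 → gradient Ω x = 0 → x = 0)
    (c : ℝ) (hc : 0 < c)
    (hgrad : ∀ x ∈ D, c * ‖x‖ ^ q ≤ ‖gradient Ω x‖)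
    (p : ℝ) (hp : p < (d : ℝ) - q) :
    ∫⁻ x in ({y ∈ D | Ω y = 0} \ {0}),
        ENNReal.ofReal (‖x‖ ^ (-p)) ∂(μH[(d : ℝ) - 1]) < ⊤ := by
  rcases d with _ | n
  · have : {y ∈ D | Ω y = 0} \ {0} = ∅ :=
      eq_empty_of_forall_notMem fun x hx => hx.2 (Subsingleton.elim _ _)
    simp [this]
  rw [show ((n + 1 : ℕ) : ℝ) - 1 = n by push_cast; ring]
  have hSball : {y ∈ D | Ω y = 0} \ {0} ⊆ ball 0 1 := fun x hx => hDball hx.1.1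
  obtain ⟨η, hη, C, hC, h⟩ := exists_hausdorffMeasure_zeroSet_inter_closedBall_le (n := n)
    (by simp) (hΩ.of_le (by norm_num)) hSball fun x hx => hx.1.2
  have hSm : MeasurableSet ({y ∈ D | Ω y = 0} \ {0}) :=
    (hD.measurableSet.inter (isClosed_eq hΩ.continuous continuous_const).measurableSet).diff
      (measurableSet_singleton 0)
  refine lintegral_norm_rpow_lt_top_of_measure_inter_closedBall_le (n := n) (η := η * c) (by simp)
    _ hSm hSball (fun h => h.2 rfl) hq (by positivity) hC (fun x hx R hR hRη => ?_)
    (by push_cast at hp; exact hp)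
  refine h x hx (fun hg => hx.2 (hcrit x hx.1.1 hx.1.2 hg)) R hR (hRη.trans ?_)
  rw [mul_assoc]
  gcongr
  exact hgrad x hx.1.1
end
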